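/- Under conditions (D), (X*) and (G1), with p=P(Y=1)∈(0,1) and μ(x)∈(0,1), setting R(x,p)=p·(1−μ(x))/((1−p)·μ(x)) and F̄_j=1−F_j for the class-conditional c.d.f.s F_j(t)=P(d(x,X)≤t∣Y=j), one has F̄_0( F̄_1^{−1}(v) ) = 1 − R(x,p)·(1−v) + O( (1−v)^{1+1/d} ) as v→1. -/

import Mathlib

open MeasureTheory ProbabilityTheory Filter
open scoped ENNReal NNReal Topology Classical

theorem continuous_measureReal_Iic (ν : Measure ℝ) [IsProbabilityMeasure ν] [NullSingletonClass ν] :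
    Continuous fun t => ν.real (Set.Iic t) := by
  have h : (fun t => ν.real (Set.Iic t)) = cdf ν := funext fun t => (cdf_eq_real ν t).symm
  rw [h, continuous_iff_continuousAt]
  intro t
  rw [(monotone_cdf ν).continuousAt_iff_leftLim_eq_rightLim, (cdf ν).rightLim_eq]
  have h1 : (cdf ν).measure {t} = 0 := by rw [measure_cdf, measure_singleton]
  rw [StieltjesFunction.measure_singleton, ENNReal.ofReal_eq_zero, sub_nonpos] at h1
  exact le_antisymm ((monotone_cdf ν).leftLim_le le_rfl) h1

theorem sInf_superlevel_spec {F : ℝ → ℝ} (hmono : Monotone F) (hcont : Continuous F) {u s : ℝ}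
    (hneg : ∀ t < 0, F t < u) (hs : u ≤ F s) :
    0 ≤ sInf {t | u ≤ F t} ∧ sInf {t | u ≤ F t} ≤ s ∧ F (sInf {t | u ≤ F t}) = u := by
  have hlb : ∀ t ∈ {t | u ≤ F t}, (0 : ℝ) ≤ t := fun t ht => by
    by_contra! h
    exact absurd (hneg t h) (not_lt.2 ht)
  have hbdd : BddBelow {t | u ≤ F t} := ⟨0, hlb⟩
  have hmem : sInf {t | u ≤ F t} ∈ {t | u ≤ F t} :=
    (isClosed_le continuous_const hcont).csInf_mem ⟨s, hs⟩ hbdd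
  obtain ⟨c, -, hc⟩ := intermediate_value_Icc (show (-1 : ℝ) ≤ s by linarith [hlb s hs])
    hcont.continuousOn ⟨(hneg (-1) (by norm_num)).le, hs⟩
  refine ⟨le_csInf ⟨s, hs⟩ hlb, csInf_le hbdd hs, le_antisymm ?_ hmem⟩
  exact (hmono (csInf_le hbdd hc.ge)).trans hc.le

theorem abs_setIntegral_closedBall_sub_le {E : Type*} [MetricSpace E] [ProperSpace E]
    [MeasurableSpace E] [BorelSpace E] (P : Measure E) [IsFiniteMeasure P] {f : E → ℝ} {L : ℝ≥0}
    (hf : LipschitzWith L f) (x : E) (t : ℝ) :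
    |∫ y in Metric.closedBall x t, f y ∂P - f x * P.real (Metric.closedBall x t)| ≤
      L * t * P.real (Metric.closedBall x t) := by
  have hint : IntegrableOn f (Metric.closedBall x t) P :=
    hf.continuous.continuousOn.integrableOn_compact (isCompact_closedBall x t)
  have hsub : ∫ y in Metric.closedBall x t, f y ∂P - f x * P.real (Metric.closedBall x t) =
      ∫ y in Metric.closedBall x t, (f y - f x) ∂P := by
    rw [integral_sub hint (integrable_const _), setIntegral_const, smul_eq_mul, mul_comm (f x)]
  rw [hsub, ← Real.norm_eq_abs]
  refine norm_setIntegral_le_of_norm_le_const (measure_lt_top _ _) fun y hy => ?_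
  rw [← dist_eq_norm]
  exact (hf.dist_le_mul y x).trans (mul_le_mul_of_nonneg_left hy L.2)

theorem abs_sub_odds_mul_le {p a L t g g1 : ℝ} (hp : p ∈ Set.Ioo (0 : ℝ) 1) (ha : 0 < a)
    (ht : 0 ≤ t) (hL : 0 ≤ L) (hLt : L * t ≤ a / 2) (hg : 0 ≤ g)
    (h : |g1 - a * g| ≤ L * t * g) :
    |(g - g1) / (1 - p) - p * (1 - a) / ((1 - p) * a) * (g1 / p)| ≤
      2 * L / ((1 - p) * a ^ 2) * (t * g1) := by
  obtain ⟨hp0, hp1⟩ := hp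
  have hq : 0 < 1 - p := sub_pos.2 hp1
  have heq : (g - g1) / (1 - p) - p * (1 - a) / ((1 - p) * a) * (g1 / p) =
      -(g1 - a * g) / ((1 - p) * a) := by
    field_simp
    ring
  have hgle : g ≤ 2 * g1 / a := by
    rw [le_div_iff₀ ha]
    nlinarith [(abs_le.1 h).1, mul_le_mul_of_nonneg_right hLt hg]
  rw [heq, abs_div, abs_neg, abs_of_pos (mul_pos hq ha), div_le_iff₀ (mul_pos hq ha)]
  calc |g1 - a * g| ≤ L * t * g := h
    _ ≤ L * t * (2 * g1 / a) := by gcongr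
    _ = 2 * L / ((1 - p) * a ^ 2) * (t * g1) * ((1 - p) * a) := by field_simp

/-- **Expansion of `F̄₀(F̄₁⁻¹(v))` near `v = 1`** (Lemma C.4).
`(X,Y)` is a random pair in `ℝ^d × {0,1}` (`ℝ^d = Fin d → ℝ` with the max-norm) with
`p = P(Y=1) ∈ (0,1)` and regression function `μ`, `L`-Lipschitz (G1), with `μ(x) ∈ (0,1)`.
Under (D) (the c.d.f. of `d(x,X)` is nonatomic) and (X*) (the class-conditional laws of `X`
have densities bounded below near `x`), with `F_j(t) = P(d(x,X) ≤ t | Y = j)`, `F̄_j = 1 - F_j`,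
`F̄₁⁻¹` the generalized inverse of `F̄₁`, and `R(x,p) = p(1-μ(x))/((1-p)μ(x))`, one has
`F̄₀(F̄₁⁻¹(v)) = 1 − R(x,p)(1−v) + O((1−v)^{1+1/d})` as `v → 1⁻`. -/
theorem classwise_cdf_composition_expansion
    {Ω : Type*} [MeasureSpace Ω] [IsProbabilityMeasure (ℙ : Measure Ω)]
    {d : ℕ} (hd : 0 < d)
    (X : Ω → (Fin d → ℝ)) (Y : Ω → Bool) (hX : Measurable X) (hY : Measurable Y)
    (x : Fin d → ℝ)
    (p : ℝ) (hpdef : p = ((ℙ : Measure Ω) (Y ⁻¹' {true})).toReal)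
    (hp : p ∈ Set.Ioo (0:ℝ) 1)
    -- (D): the c.d.f. `F(t) = P(d(x,X) ≤ t)` is nonatomic
    (hD : ∀ t : ℝ, (ℙ : Measure Ω) {ω | dist x (X ω) = t} = 0)
    -- (G1): the regression function `μ` is `L`-Lipschitz for the max-norm
    (μ : (Fin d → ℝ) → ℝ) (hμmeas : Measurable μ) (L : ℝ≥0) (hLip : LipschitzWith L μ)
    (hμver : ∀ A : Set (Fin d → ℝ), MeasurableSet A →
      ∫ y in A, μ y ∂(Measure.map X (ℙ : Measure Ω)) =
        ((ℙ : Measure Ω) (X ⁻¹' A ∩ Y ⁻¹' {true})).toReal)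
    (hμx : μ x ∈ Set.Ioo (0:ℝ) 1)
    -- (X*): the class-conditional laws of `X` have densities bounded below near `x`
    (m ε : ℝ) (hm : 0 < m) (hε : 0 < ε)
    (hdens0 : ∀ A ⊆ Metric.ball x ε, MeasurableSet A →
      ENNReal.ofReal m * volume A ≤ Measure.map X ((ℙ : Measure Ω)[|Y ⁻¹' {false}]) A)
    (hdens1 : ∀ A ⊆ Metric.ball x ε, MeasurableSet A →
      ENNReal.ofReal m * volume A ≤ Measure.map X ((ℙ : Measure Ω)[|Y ⁻¹' {true}]) A)
    -- the class-conditional c.d.f.s and the generalized inverse of `F̄₁`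
    (F0 F1 : ℝ → ℝ)
    (hF0 : ∀ t, F0 t = (((ℙ : Measure Ω)[|Y ⁻¹' {false}]) {ω | dist x (X ω) ≤ t}).toReal)
    (hF1 : ∀ t, F1 t = (((ℙ : Measure Ω)[|Y ⁻¹' {true}]) {ω | dist x (X ω) ≤ t}).toReal)
    (F1barInv : ℝ → ℝ) (hF1barInv : ∀ v, F1barInv v = sInf {t : ℝ | 1 - F1 t ≤ v})
    -- the odds ratio `R(x,p)`
    (R : ℝ) (hR : R = p * (1 - μ x) / ((1 - p) * μ x)) :
    ∃ C : ℝ, ∃ δ : ℝ, 0 < δ ∧ ∀ v : ℝ, 1 - δ ≤ v → v < 1 →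
      |(1 - F0 (F1barInv v)) - (1 - R * (1 - v))| ≤
        C * (1 - v) ^ ((1 : ℝ) + 1 / d) := by
  obtain ⟨hp0, hp1⟩ := hp
  have hd' : (d : ℝ) ≠ 0 := by positivity
  have hYt : MeasurableSet (Y ⁻¹' {true}) := hY (measurableSet_singleton _)
  have hYf : MeasurableSet (Y ⁻¹' {false}) := hY (measurableSet_singleton _)
  have hcompl : Y ⁻¹' {false} = (Y ⁻¹' {true})ᶜ := by ext ω; simp
  have hball : ∀ t, {ω | dist x (X ω) ≤ t} = X ⁻¹' Metric.closedBall x t := fun t => by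
    ext ω; simp [dist_comm]
  have hpt : (ℙ : Measure Ω).real (Y ⁻¹' {true}) = p := hpdef.symm
  have hpf : (ℙ : Measure Ω).real (Y ⁻¹' {false}) = 1 - p := by
    rw [hcompl, probReal_compl_eq_one_sub hYt, hpt]
  have hYt0 : (ℙ : Measure Ω) (Y ⁻¹' {true}) ≠ 0 := fun h => by
    simp [measureReal_def, h] at hpt; linarith
  have : IsProbabilityMeasure (Measure.map X (ℙ : Measure Ω)) :=
    Measure.isProbabilityMeasure_map hX.aemeasurable
  have : IsProbabilityMeasure ((ℙ : Measure Ω)[|Y ⁻¹' {true}]) := cond_isProbabilityMeasure hYt0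
  set G : ℝ → ℝ := fun t => (Measure.map X (ℙ : Measure Ω)).real (Metric.closedBall x t)
  set G1 : ℝ → ℝ := fun t => ∫ y in Metric.closedBall x t, μ y ∂(Measure.map X (ℙ : Measure Ω))
  have hGX : ∀ t, G t = (ℙ : Measure Ω).real (X ⁻¹' Metric.closedBall x t) := fun t =>
    map_measureReal_apply hX Metric.isClosed_closedBall.measurableSet
  have hG1X : ∀ t, G1 t =
      (ℙ : Measure Ω).real (X ⁻¹' Metric.closedBall x t ∩ Y ⁻¹' {true}) := fun t =>
    hμver _ Metric.isClosed_closedBall.measurableSet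
  have hF1G : ∀ t, F1 t = G1 t / p := fun t => by
    rw [hF1, hball, cond_apply hYt, ENNReal.toReal_mul, ENNReal.toReal_inv,
      ← measureReal_def, ← measureReal_def, hpt, hG1X, Set.inter_comm]
    ring
  have hF0G : ∀ t, F0 t = (G t - G1 t) / (1 - p) := fun t => by
    have h := measureReal_inter_add_sdiff (μ := (ℙ : Measure Ω))
      (s := X ⁻¹' Metric.closedBall x t) hYt
    rw [hF0, hball, cond_apply hYf, ENNReal.toReal_mul, ENNReal.toReal_inv,
      ← measureReal_def, ← measureReal_def, hpf, hG1X, hGX, ← h,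
      hcompl, Set.inter_comm, ← Set.sdiff_eq]
    ring
  -- the law of the distance given `Y = 1` is a nonatomic probability measure with c.d.f. `F1`
  have hdist : Measurable fun ω => dist x (X ω) := measurable_const.dist hX
  set ν : Measure ℝ := Measure.map (fun ω => dist x (X ω)) ((ℙ : Measure Ω)[|Y ⁻¹' {true}])
    with hν
  have : IsProbabilityMeasure ν := Measure.isProbabilityMeasure_map hdist.aemeasurable
  have : NullSingletonClass ν := ⟨fun t => by
    rw [hν, Measure.map_apply hdist (measurableSet_singleton t)]
    exact cond_absolutelyContinuous (hD t)⟩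
  have hF1ν : F1 = fun t => ν.real (Set.Iic t) := funext fun t => by
    rw [hF1, map_measureReal_apply hdist measurableSet_Iic]
    rfl
  have hcont : Continuous F1 := hF1ν ▸ continuous_measureReal_Iic ν
  have hmono : Monotone F1 := fun s t hst => by
    rw [hF1ν]
    exact measureReal_mono (Set.Iic_subset_Iic.2 hst)
  have hneg : ∀ t < 0, F1 t = 0 := fun t ht => by
    rw [hF1, hball, Metric.closedBall_eq_empty.2 ht]
    simp
  have hlow : ∀ t, 0 < t → t ≤ ε → m * (2 * t) ^ d ≤ F1 t := fun t ht htε => by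
    have h := hdens1 (Metric.ball x t) (Metric.ball_subset_ball htε) measurableSet_ball
    rw [Real.volume_pi_ball x ht, Fintype.card_fin, ← ENNReal.ofReal_mul hm.le,
      Measure.map_apply hX measurableSet_ball] at h
    rw [hF1, hball, ← ENNReal.ofReal_le_iff_le_toReal (measure_ne_top _ _)]
    exact h.trans (measure_mono (Set.preimage_mono Metric.ball_subset_closedBall))
  have hμ0 := hμx.1
  have hL1 : (0 : ℝ) < L + 1 := by positivity
  set r : ℝ := min ε (μ x / (2 * (L + 1))) with hr
  have hr0 : 0 < r := by positivity
  have hLr : L * r ≤ μ x / 2 := by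
    calc L * r ≤ (L + 1) * (μ x / (2 * (L + 1))) := by
          gcongr
          · linarith
          · exact min_le_right _ _
      _ = μ x / 2 := by field_simp
  refine ⟨2 * L / ((1 - p) * μ x ^ 2) * (p * ((1 / m) ^ (1 / (d : ℝ)) / 2)),
    m * (2 * r) ^ d, by positivity, fun v hv hv1 => ?_⟩
  have hu : 0 < 1 - v := sub_pos.2 hv1
  set u := 1 - v with hudef
  have hur : u ≤ m * (2 * r) ^ d := by linarith
  set s : ℝ := (1 / m * u) ^ (1 / (d : ℝ)) / 2 with hs
  have hs0 : 0 < s := by positivity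
  have hsd : m * (2 * s) ^ d = u := by
    rw [hs, mul_div_cancel₀ _ two_ne_zero, ← Real.rpow_natCast, ← Real.rpow_mul (by positivity),
      one_div_mul_cancel hd', Real.rpow_one]
    field_simp
  have hsr : s ≤ r := by
    have h : (2 * s) ^ d ≤ (2 * r) ^ d := le_of_mul_le_mul_left (hsd.trans_le hur) hm
    linarith [le_of_pow_le_pow_left₀ hd.ne' (by positivity) h]
  obtain ⟨ht0, hts, hFt⟩ := sInf_superlevel_spec hmono hcont
    (fun t ht => (hneg t ht).trans_lt hu) (hsd.ge.trans (hlow s hs0 (hsr.trans (min_le_left _ _))))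
  have hinv : F1barInv v = sInf {t | u ≤ F1 t} := by
    rw [hF1barInv]
    congr 1
    ext t
    simp only [Set.mem_ofPred_eq, hudef]
    constructor <;> intro h <;> linarith
  rw [← hinv] at ht0 hts hFt
  set t := F1barInv v
  have hLt : L * t ≤ μ x / 2 :=
    (mul_le_mul_of_nonneg_left (hts.trans hsr) L.2).trans hLr
  have hmain := abs_sub_odds_mul_le ⟨hp0, hp1⟩ hμ0 ht0 L.2 hLt measureReal_nonneg
    (abs_setIntegral_closedBall_sub_le (Measure.map X (ℙ : Measure Ω)) hLip x t)
  have hG1u : G1 t = p * u := by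
    rw [← hFt, hF1G]
    field_simp
  calc |1 - F0 t - (1 - R * u)| = |F0 t - R * F1 t| := by
        rw [hFt, ← abs_neg]
        congr 1
        ring
    _ ≤ 2 * L / ((1 - p) * μ x ^ 2) * (t * G1 t) := by
        rw [hF0G, hF1G, hR]
        exact hmain
    _ ≤ 2 * L / ((1 - p) * μ x ^ 2) * (s * (p * u)) := by
        have hq : 0 < 1 - p := sub_pos.2 hp1
        rw [hG1u]
        gcongr
    _ = 2 * L / ((1 - p) * μ x ^ 2) * (p * ((1 / m) ^ (1 / (d : ℝ)) / 2)) *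
          u ^ ((1 : ℝ) + 1 / d) := by
        rw [hs, Real.mul_rpow (by positivity) hu.le, Real.rpow_add hu, Real.rpow_one]
        ring
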